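/- arXiv:2104.06160 — 5 statements merged into one kernel-verified Lean document; each statement's English description precedes it below -/
import Mathlib

section
/- Let X be a real random variable with the exponential distribution of rate λ_rw > 0, let P_r > 0, σ_w² ∈ ℝ, c > 0 and q ∈ [0, 1]. Define the detection error probability ξ(τ) = (1 − q) · P(P_r X + σ_w² > τ) + q · P(P_r X + c + σ_w² < τ). Then ξ(τ) = 1 − q for τ ≤ σ_w²; ξ(τ) = (1 − q) exp(−λ_rw(τ − σ_w²)/P_r) for σ_w² < τ ≤ σ_w² + c; and ξ(τ) = (1 − q) exp(−λ_rw(τ − σ_w²)/P_r) + q(1 − exp(−λ_rw(τ − σ_w² − c)/P_r)) for τ > σ_w² + c. -/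
open MeasureTheory ProbabilityTheory

/-- Lemma 3: Willie's detection error probability
`ξ(τ) = (1 − q) · P(P_r X + σ_w² > τ) + q · P(P_r X + c + σ_w² < τ)`, where `X` is
exponentially distributed with rate `λ_rw > 0`, equals `1 − q` for `τ ≤ σ_w²`;
`(1 − q) exp(−λ_rw(τ − σ_w²)/P_r)` for `σ_w² < τ ≤ σ_w² + c`; and
`(1 − q) exp(−λ_rw(τ − σ_w²)/P_r) + q(1 − exp(−λ_rw(τ − σ_w² − c)/P_r))` for
`τ > σ_w² + c`. -/
theorem stmt_5 {Ω : Type*} [MeasurableSpace Ω] (μ : Measure Ω) [IsProbabilityMeasure μ]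
    (X : Ω → ℝ) (hX : Measurable X) (lrw : ℝ) (hlrw : 0 < lrw)
    (hlaw : μ.map X = expMeasure lrw)
    (Pr σw2 c q : ℝ) (hPr : 0 < Pr) (hc : 0 < c) (hq : q ∈ Set.Icc (0:ℝ) 1)
    (ξ : ℝ → ℝ)
    (hξ : ∀ τ : ℝ, ξ τ = (1 - q) * (μ {ω | Pr * X ω + σw2 > τ}).toReal
        + q * (μ {ω | Pr * X ω + c + σw2 < τ}).toReal) :
    (∀ τ : ℝ, τ ≤ σw2 → ξ τ = 1 - q) ∧
    (∀ τ : ℝ, σw2 < τ → τ ≤ σw2 + c →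
      ξ τ = (1 - q) * Real.exp (-(lrw * (τ - σw2)) / Pr)) ∧
    (∀ τ : ℝ, σw2 + c < τ →
      ξ τ = (1 - q) * Real.exp (-(lrw * (τ - σw2)) / Pr)
        + q * (1 - Real.exp (-(lrw * (τ - σw2 - c)) / Pr))) := by
  haveI := isProbabilityMeasure_expMeasure hlrw
  have hIic : ∀ x : ℝ, (expMeasure lrw).real (Set.Iic x)
      = if 0 ≤ x then 1 - Real.exp (-(lrw * x)) else 0 := fun x => by
    rw [← cdf_expMeasure_eq hlrw x, cdf_eq_real]
  have hatom : ∀ x : ℝ, expMeasure lrw {x} = 0 := fun x => by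
    have h : expMeasure lrw ≪ volume := withDensity_absolutelyContinuous _ _
    exact h (by simp)
  have hIio : ∀ x : ℝ, (expMeasure lrw).real (Set.Iio x)
      = if 0 ≤ x then 1 - Real.exp (-(lrw * x)) else 0 := fun x => by
    rw [← hIic x]
    exact measureReal_congr (Iio_ae_eq_Iic' (hatom x))
  have hIoi : ∀ x : ℝ, (expMeasure lrw).real (Set.Ioi x)
      = 1 - if 0 ≤ x then 1 - Real.exp (-(lrw * x)) else 0 := fun x => by
    rw [← hIic x, ← Set.compl_Iic, probReal_compl_eq_one_sub measurableSet_Iic]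
  have h1 : ∀ τ : ℝ, (μ {ω | Pr * X ω + σw2 > τ}).toReal
      = 1 - if 0 ≤ (τ - σw2) / Pr then 1 - Real.exp (-(lrw * ((τ - σw2) / Pr))) else 0 := by
    intro τ
    rw [← hIoi, ← hlaw, Measure.real, Measure.map_apply hX measurableSet_Ioi]
    congr 2
    ext ω
    simp only [Set.mem_setOf_eq, Set.mem_preimage, Set.mem_Ioi, div_lt_iff₀ hPr]
    constructor <;> intro h <;> linarith
  have h2 : ∀ τ : ℝ, (μ {ω | Pr * X ω + c + σw2 < τ}).toReal
      = if 0 ≤ (τ - σw2 - c) / Pr then 1 - Real.exp (-(lrw * ((τ - σw2 - c) / Pr))) else 0 := by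
    intro τ
    rw [← hIio, ← hlaw, Measure.real, Measure.map_apply hX measurableSet_Iio]
    congr 2
    ext ω
    simp only [Set.mem_setOf_eq, Set.mem_preimage, Set.mem_Iio, lt_div_iff₀ hPr]
    constructor <;> intro h <;> linarith
  have e : ∀ t : ℝ, -(lrw * t) / Pr = -(lrw * (t / Pr)) := fun t => by ring
  have z : ∀ t : ℝ, t ≤ 0 →
      (if 0 ≤ t / Pr then 1 - Real.exp (-(lrw * (t / Pr))) else 0) = 0 := by
    intro t ht
    split_ifs with h
    · have : t / Pr = 0 := le_antisymm (div_nonpos_of_nonpos_of_nonneg ht hPr.le) h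
      simp [this]
    · rfl
  have p : ∀ t : ℝ, 0 ≤ t →
      (if 0 ≤ t / Pr then 1 - Real.exp (-(lrw * (t / Pr))) else 0)
        = 1 - Real.exp (-(lrw * t) / Pr) := by
    intro t ht
    rw [if_pos (div_nonneg ht hPr.le), e]
  refine ⟨fun τ h => ?_, fun τ h h' => ?_, fun τ h => ?_⟩
  · rw [hξ, h1, h2, z _ (by linarith), z _ (by linarith)]; ring
  · rw [hξ, h1, h2, p _ (by linarith), z _ (by linarith)]; ring
  · rw [hξ, h1, h2, p _ (by linarith), p _ (by linarith)]; ring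
end

section
/- Let λ > 0, P_r > 0, σ² ∈ ℝ, c > 0 and q ∈ [0, 1], and set μ = λ c / P_r. Define ξ : ℝ → ℝ by ξ(τ) = 1 − q for τ ≤ σ²; ξ(τ) = (1 − q) exp(−λ(τ − σ²)/P_r) for σ² < τ ≤ σ² + c; and ξ(τ) = (1 − q) exp(−λ(τ − σ²)/P_r) + q(1 − exp(−λ(τ − σ² − c)/P_r)) for τ > σ² + c. Then the infimum of ξ over τ ∈ ℝ equals q if q ≤ 1/(1 + exp(μ)) and equals (1 − q) exp(−μ) if q > 1/(1 + exp(μ)); moreover, in the latter case the infimum is attained at τ = σ² + c. -/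
open Real

/-- Theorem 2: the infimum over `τ ∈ ℝ` of Willie's detection error probability `ξ(τ)`
equals `q` if `q ≤ 1/(1 + exp μ)` and equals `(1 − q) exp(−μ)` if `q > 1/(1 + exp μ)`
(with `μ = λ c / P_r`); in the latter case the infimum is attained at `τ = σ² + c`. -/
theorem stmt_6 (l Pr σ2 c q μ : ℝ) (hl : 0 < l) (hPr : 0 < Pr) (hc : 0 < c)
    (hq : q ∈ Set.Icc (0:ℝ) 1) (hμ : μ = l * c / Pr)
    (ξ : ℝ → ℝ)
    (hξ1 : ∀ τ : ℝ, τ ≤ σ2 → ξ τ = 1 - q)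
    (hξ2 : ∀ τ : ℝ, σ2 < τ → τ ≤ σ2 + c →
      ξ τ = (1 - q) * Real.exp (-(l * (τ - σ2)) / Pr))
    (hξ3 : ∀ τ : ℝ, σ2 + c < τ →
      ξ τ = (1 - q) * Real.exp (-(l * (τ - σ2)) / Pr)
        + q * (1 - Real.exp (-(l * (τ - σ2 - c)) / Pr))) :
    (q ≤ 1 / (1 + Real.exp μ) → IsGLB (Set.range ξ) q) ∧
    (1 / (1 + Real.exp μ) < q →
      IsGLB (Set.range ξ) ((1 - q) * Real.exp (-μ)) ∧
      ξ (σ2 + c) = (1 - q) * Real.exp (-μ)) := by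
  obtain ⟨hq0, hq1⟩ := hq
  have hμ0 : 0 < μ := by rw [hμ]; positivity
  have hE0 : 0 < Real.exp (-μ) := Real.exp_pos _
  have hE1 : Real.exp (-μ) < 1 := by rw [Real.exp_lt_one_iff]; linarith
  have hEE : Real.exp μ * Real.exp (-μ) = 1 := by rw [← Real.exp_add]; simp
  have hF0 : 0 < Real.exp μ := Real.exp_pos _
  have hsplit : ∀ τ : ℝ, Real.exp (-(l * (τ - σ2)) / Pr)
      = Real.exp (-μ) * Real.exp (-(l * (τ - σ2 - c)) / Pr) := by
    intro τ
    rw [← Real.exp_add, hμ]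
    congr 1
    field_simp
    ring
  have hmid : ∀ τ : ℝ, τ ≤ σ2 + c → (1 - q) * Real.exp (-μ) ≤ ξ τ := by
    intro τ h
    rcases le_or_gt τ σ2 with h1 | h1
    · rw [hξ1 τ h1]; nlinarith
    · rw [hξ2 τ h1 h]
      apply mul_le_mul_of_nonneg_left _ (by linarith)
      rw [Real.exp_le_exp, hμ, ← neg_div]
      apply div_le_div_of_nonneg_right _ hPr.le
      nlinarith
  have ht1 : ∀ τ : ℝ, σ2 + c < τ → Real.exp (-(l * (τ - σ2 - c)) / Pr) < 1 := by
    intro τ h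
    rw [Real.exp_lt_one_iff]
    apply div_neg_of_neg_of_pos _ hPr
    have : 0 < l * (τ - σ2 - c) := mul_pos hl (by linarith)
    linarith
  constructor
  · intro h
    rw [le_div_iff₀ (by positivity)] at h
    have hK : q ≤ (1 - q) * Real.exp (-μ) := by nlinarith
    constructor
    · rintro _ ⟨τ, rfl⟩
      rcases le_or_gt τ (σ2 + c) with h1 | h1
      · exact hK.trans (hmid τ h1)
      · rw [hξ3 τ h1, hsplit]
        nlinarith [Real.exp_pos (-(l * (τ - σ2 - c)) / Pr)]
    · intro b hb
      by_contra hlt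
      rw [not_le] at hlt
      have key : ∀ t : ℝ, 0 < t → t < 1 →
          b ≤ q + ((1 - q) * Real.exp (-μ) - q) * t := by
        intro t h0 h1
        have hlog := Real.log_neg h0 h1
        have hτ : σ2 + c < σ2 + c + Pr * (-Real.log t) / l := by
          have : 0 < Pr * (-Real.log t) / l := div_pos (mul_pos hPr (by linarith)) hl
          linarith
        have h2 := hb ⟨_, rfl⟩ |>.trans_eq (hξ3 _ hτ)
        rw [hsplit] at h2
        have h3 : -(l * (σ2 + c + Pr * (-Real.log t) / l - σ2 - c)) / Pr = Real.log t := by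
          field_simp
          ring
        rw [h3, Real.exp_log h0] at h2
        linarith
      have hK1 : (1 - q) * Real.exp (-μ) - q < 1 := by nlinarith
      have hm0 : 0 < min (1/2) ((b - q) / 2) := lt_min (by norm_num) (by linarith)
      have := key (min (1/2) ((b - q) / 2)) hm0
        (lt_of_le_of_lt (min_le_left _ _) (by norm_num))
      nlinarith [min_le_right (1/2) ((b - q) / 2)]
  · intro h
    rw [div_lt_iff₀ (by positivity)] at h
    have hK : (1 - q) * Real.exp (-μ) ≤ q := by nlinarith
    have hat : ξ (σ2 + c) = (1 - q) * Real.exp (-μ) := by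
      rw [hξ2 _ (by linarith) le_rfl, hμ]
      congr 2
      ring
    refine ⟨⟨?_, fun b hb => hat ▸ hb ⟨_, rfl⟩⟩, hat⟩
    rintro _ ⟨τ, rfl⟩
    rcases le_or_gt τ (σ2 + c) with h1 | h1
    · exact hmid τ h1
    · rw [hξ3 τ h1, hsplit]
      nlinarith [ht1 τ h1]
end

section
/- Let γ > 0 and μ₁ > 0, and define h : (0, ∞) → ℝ by h(P_s) = exp(−γ/P_s) / (1 + μ₁ P_s). Let μ₃ = (γ/2)(√(1 + 4/(μ₁ γ)) + 1), which is the unique positive root of the quadratic P_s² − γ P_s − γ/μ₁ = 0. Then h is strictly monotonically increasing on (0, μ₃] and strictly monotonically decreasing on [μ₃, ∞). -/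
/-- Let `γ > 0`, `μ₁ > 0`, and `h(P_s) = exp(−γ/P_s)/(1 + μ₁ P_s)`. Let
`μ₃ = (γ/2)(√(1 + 4/(μ₁ γ)) + 1)`, the unique positive root of
`P_s² − γ P_s − γ/μ₁ = 0`. Then `h` is strictly increasing on `(0, μ₃]` and strictly
decreasing on `[μ₃, ∞)`. -/
theorem stmt_9 (γ μ₁ : ℝ) (hγ : 0 < γ) (hμ₁ : 0 < μ₁)
    (h : ℝ → ℝ) (hh : ∀ Ps : ℝ, 0 < Ps → h Ps = Real.exp (-γ / Ps) / (1 + μ₁ * Ps))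
    (μ₃ : ℝ) (hμ₃ : μ₃ = (γ / 2) * (Real.sqrt (1 + 4 / (μ₁ * γ)) + 1)) :
    (μ₃ ^ 2 - γ * μ₃ - γ / μ₁ = 0 ∧
      ∀ x : ℝ, 0 < x → x ^ 2 - γ * x - γ / μ₁ = 0 → x = μ₃) ∧
    StrictMonoOn h (Set.Ioc 0 μ₃) ∧
    StrictAntiOn h (Set.Ici μ₃) := by
  have hs0 : 0 ≤ 1 + 4 / (μ₁ * γ) := by positivity
  have hsq := Real.sq_sqrt hs0
  have hs1 : 1 < Real.sqrt (1 + 4 / (μ₁ * γ)) := by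
    apply Real.lt_sqrt_of_sq_lt
    have : 0 < 4 / (μ₁ * γ) := by positivity
    linarith
  have hroot : μ₃ ^ 2 - γ * μ₃ - γ / μ₁ = 0 := by
    have e : μ₃ ^ 2 - γ * μ₃ - γ / μ₁
        = γ ^ 2 / 4 * (Real.sqrt (1 + 4 / (μ₁ * γ)) ^ 2 - 1) - γ / μ₁ := by
      rw [hμ₃]; ring
    rw [e, hsq]
    field_simp
    ring
  have hgt : γ < μ₃ := by
    rw [hμ₃]; nlinarith
  have hpos : 0 < μ₃ := hγ.trans hgt
  have hfac : ∀ x : ℝ, x ^ 2 - γ * x - γ / μ₁ = (x - μ₃) * (x + μ₃ - γ) := by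
    intro x; linear_combination hroot
  have hder : ∀ x : ℝ, 0 < x → HasDerivAt h
      (Real.exp (-γ / x) * (μ₁ * ((μ₃ - x) * (x + μ₃ - γ))) / (x ^ 2 * (1 + μ₁ * x) ^ 2)) x := by
    intro x hx
    have hd : 1 + μ₁ * x ≠ 0 := by positivity
    have h1 : HasDerivAt (fun y : ℝ => -γ / y) (γ / x ^ 2) x := by
      have := (hasDerivAt_const x (-γ)).div (hasDerivAt_id x) hx.ne'
      refine this.congr_deriv ?_
      simp
    have h2 : HasDerivAt (fun y : ℝ => 1 + μ₁ * y) μ₁ x := by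
      simpa using ((hasDerivAt_id x).const_mul μ₁).const_add 1
    have h3 := h1.exp.div h2 hd
    have h4 : h =ᶠ[nhds x] fun y => Real.exp (-γ / y) / (1 + μ₁ * y) := by
      filter_upwards [lt_mem_nhds hx] with y hy using hh y hy
    have h5 := h3.congr_of_eventuallyEq h4
    refine h5.congr_deriv ?_
    have e : (μ₃ - x) * (x + μ₃ - γ) = -(x ^ 2 - γ * x - γ / μ₁) := by
      rw [hfac]; ring
    rw [e]
    field_simp
    ring
  refine ⟨⟨hroot, ?_⟩, ?_, ?_⟩
  · intro x hx hx0
    rw [hfac] at hx0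
    rcases mul_eq_zero.mp hx0 with h0 | h0 <;> linarith
  · apply strictMonoOn_of_deriv_pos (convex_Ioc 0 μ₃)
    · intro x hx
      exact (hder x hx.1).continuousAt.continuousWithinAt
    · intro x hx
      rw [interior_Ioc] at hx
      have hx0 := hx.1
      rw [(hder x hx.1).deriv]
      have a : 0 < μ₃ - x := by linarith [hx.2]
      have b : 0 < x + μ₃ - γ := by linarith
      positivity
  · apply strictAntiOn_of_deriv_neg (convex_Ici μ₃)
    · intro x hx
      exact (hder x (hpos.trans_le hx)).continuousAt.continuousWithinAt
    · intro x hx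
      rw [interior_Ici] at hx
      have hx1 : μ₃ < x := hx
      have hx0 : 0 < x := hpos.trans hx1
      rw [(hder x hx0).deriv]
      have a : 0 < x - μ₃ := by linarith
      have b : 0 < x + μ₃ - γ := by linarith
      have c : 0 < Real.exp (-γ / x) * (μ₁ * ((x - μ₃) * (x + μ₃ - γ)))
          / (x ^ 2 * (1 + μ₁ * x) ^ 2) := by positivity
      rw [← neg_pos]
      convert c using 1
      ring
end

section
/- Let γ > 0, μ₁ > 0, R > 0 and P_m > 0. Set μ₃ = (γ/2)(√(1 + 4/(μ₁ γ)) + 1) and κ₁ = min(μ₃, P_m). Then for all P_s ∈ (0, P_m] and all p ∈ (0, 1], the effective covert rate R_c(P_s, p) = R · exp(−γ/P_s) / (1 + (1 − p)/p² + μ₁ P_s) satisfies R_c(P_s, p) ≤ R · exp(−γ/κ₁) / (1 + μ₁ κ₁), with equality when P_s = κ₁ and p = 1. Consequently, the constraint R_c(P_s, p) ≥ R_m is satisfiable over the region (0, P_m] × (0, 1] if and only if R_m ≤ R · exp(−γ/κ₁) / (1 + μ₁ κ₁). -/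
theorem aux_key (γ μ k x : ℝ) (hμ : 0 < μ) (hk : 0 < k) (hx : 0 < x)
    (h : 0 ≤ (k - x) * (γ - x * μ * (k - γ))) :
    Real.exp (-γ / x) / (1 + μ * x) ≤ Real.exp (-γ / k) / (1 + μ * k) := by
  have h1 : 0 < 1 + μ * x := by positivity
  have h2 : 0 < 1 + μ * k := by positivity
  rw [div_le_div_iff₀ h1 h2]
  have e : Real.exp (-γ / k) = Real.exp (-γ / x) * Real.exp (γ / x - γ / k) := by
    rw [← Real.exp_add]; congr 1; ring
  rw [e, mul_assoc]
  apply mul_le_mul_of_nonneg_left _ (Real.exp_pos _).le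
  have h3 := Real.add_one_le_exp (γ / x - γ / k)
  have h4 : (γ / x - γ / k + 1) * (1 + μ * x) - (1 + μ * k)
      = (k - x) * (γ - x * μ * (k - γ)) / (x * k) := by
    field_simp; ring
  have h5 : 0 ≤ (k - x) * (γ - x * μ * (k - γ)) / (x * k) := by positivity
  have h6 := mul_le_mul_of_nonneg_right h3 h1.le
  linarith

/-- Feasibility condition of Theorem 3: with `μ₃ = (γ/2)(√(1 + 4/(μ₁γ)) + 1)` and
`κ₁ = min(μ₃, P_m)`, the effective covert rate
`R_c(P_s, p) = R exp(−γ/P_s)/(1 + (1 − p)/p² + μ₁ P_s)` satisfies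
`R_c(P_s, p) ≤ R exp(−γ/κ₁)/(1 + μ₁ κ₁)` on `(0, P_m] × (0, 1]`, with equality at
`(κ₁, 1)`; hence `R_c ≥ R_m` is satisfiable there iff `R_m ≤ R exp(−γ/κ₁)/(1 + μ₁ κ₁)`. -/
theorem stmt_10 (γ μ₁ R Pm : ℝ) (hγ : 0 < γ) (hμ₁ : 0 < μ₁) (hR : 0 < R) (hPm : 0 < Pm)
    (μ₃ κ₁ : ℝ) (hμ₃ : μ₃ = (γ / 2) * (Real.sqrt (1 + 4 / (μ₁ * γ)) + 1))
    (hκ₁ : κ₁ = min μ₃ Pm)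
    (Rc : ℝ → ℝ → ℝ)
    (hRc : ∀ Ps p : ℝ, Rc Ps p = R * Real.exp (-γ / Ps) / (1 + (1 - p) / p ^ 2 + μ₁ * Ps)) :
    (∀ Ps ∈ Set.Ioc (0:ℝ) Pm, ∀ p ∈ Set.Ioc (0:ℝ) 1,
      Rc Ps p ≤ R * Real.exp (-γ / κ₁) / (1 + μ₁ * κ₁)) ∧
    Rc κ₁ 1 = R * Real.exp (-γ / κ₁) / (1 + μ₁ * κ₁) ∧
    ∀ Rm : ℝ,
      ((∃ Ps ∈ Set.Ioc (0:ℝ) Pm, ∃ p ∈ Set.Ioc (0:ℝ) 1, Rm ≤ Rc Ps p) ↔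
        Rm ≤ R * Real.exp (-γ / κ₁) / (1 + μ₁ * κ₁)) := by
  have hs0 : 0 ≤ 1 + 4 / (μ₁ * γ) := by positivity
  have hs := Real.sq_sqrt hs0
  have hm : 0 < μ₃ := by rw [hμ₃]; positivity
  have hq : μ₁ * μ₃ * (μ₃ - γ) = γ := by
    have : μ₁ * μ₃ * (μ₃ - γ) = μ₁ * γ ^ 2 / 4 * (Real.sqrt (1 + 4 / (μ₁ * γ)) ^ 2 - 1) := by
      rw [hμ₃]; ring
    rw [this, hs]; field_simp; ring
  have hk : 0 < κ₁ := by rw [hκ₁]; exact lt_min hm hPm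
  have hkP : κ₁ ≤ Pm := by rw [hκ₁]; exact min_le_right _ _
  have hA : ∀ Ps ∈ Set.Ioc (0:ℝ) Pm, ∀ p ∈ Set.Ioc (0:ℝ) 1,
      Rc Ps p ≤ R * Real.exp (-γ / κ₁) / (1 + μ₁ * κ₁) := by
    rintro x ⟨hx, hxP⟩ p ⟨hp, hp1⟩
    have h1 : Real.exp (-γ / x) / (1 + μ₁ * x) ≤ Real.exp (-γ / κ₁) / (1 + μ₁ * κ₁) := by
      apply aux_key _ _ _ _ hμ₁ hk hx
      rcases le_total μ₃ Pm with hc | hc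
      · rw [hκ₁, min_eq_left hc]
        have : (μ₃ - x) * (γ - x * μ₁ * (μ₃ - γ)) = γ * (μ₃ - x) ^ 2 / μ₃ := by
          field_simp
          linear_combination (-(μ₃ - x) * x) * hq
        rw [this]; positivity
      · rw [hκ₁, min_eq_right hc]
        apply mul_nonneg (by linarith)
        rcases le_total Pm γ with h | h
        · have : 0 ≤ x * μ₁ * (γ - Pm) := mul_nonneg (by positivity) (by linarith)
          linarith
        · have : x * μ₁ * (Pm - γ) ≤ μ₃ * μ₁ * (μ₃ - γ) := by
            apply mul_le_mul _ (by linarith) (by linarith) (by positivity)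
            exact mul_le_mul_of_nonneg_right (by linarith) hμ₁.le
          linarith
    have h2 : Rc x p ≤ R * Real.exp (-γ / x) / (1 + μ₁ * x) := by
      rw [hRc]
      have : 0 ≤ (1 - p) / p ^ 2 := div_nonneg (by linarith) (by positivity)
      apply div_le_div_of_nonneg_left (by positivity) (by positivity) (by linarith)
    refine h2.trans ?_
    rw [mul_div_assoc, mul_div_assoc]
    exact mul_le_mul_of_nonneg_left h1 hR.le
  have hB : Rc κ₁ 1 = R * Real.exp (-γ / κ₁) / (1 + μ₁ * κ₁) := by
    rw [hRc]; simp
  refine ⟨hA, hB, fun Rm => ⟨?_, fun h => ?_⟩⟩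
  · rintro ⟨x, hx, p, hp, h⟩
    exact h.trans (hA x hx p hp)
  · exact ⟨κ₁, ⟨hk, hkP⟩, 1, ⟨one_pos, le_rfl⟩, hB ▸ h⟩
end

section
/- Let λ > 0, P_r > 0, σ² ∈ ℝ, c > 0 and q ∈ [0, 1], set μ = λ c/P_r, and define ξ : ℝ → ℝ as in Lemma 3: ξ(τ) = 1 − q for τ ≤ σ²; ξ(τ) = (1 − q) exp(−λ(τ − σ²)/P_r) for σ² < τ ≤ σ² + c; ξ(τ) = (1 − q) exp(−λ(τ − σ²)/P_r) + q(1 − exp(−λ(τ − σ² − c)/P_r)) for τ > σ² + c. Then (i) if q < 1, ξ is strictly monotonically decreasing on (σ², σ² + c]; and (ii) on (σ² + c, ∞), ξ is strictly monotonically increasing if q > 1/(1 + exp(μ)) and strictly monotonically decreasing if q < 1/(1 + exp(μ)). -/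
/-- Monotonicity of the detection error probability `ξ(τ)` of Lemma 3 in the threshold
`τ` (Appendix B): (i) if `q < 1`, `ξ` is strictly decreasing on `(σ², σ² + c]`; and
(ii) on `(σ² + c, ∞)`, `ξ` is strictly increasing if `q > 1/(1 + exp μ)` and strictly
decreasing if `q < 1/(1 + exp μ)`, where `μ = λ c / P_r`. -/
theorem stmt_16 (l Pr σ2 c q μ : ℝ) (hl : 0 < l) (hPr : 0 < Pr) (hc : 0 < c)
    (hq : q ∈ Set.Icc (0:ℝ) 1) (hμ : μ = l * c / Pr)
    (ξ : ℝ → ℝ)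
    (hξ1 : ∀ τ : ℝ, τ ≤ σ2 → ξ τ = 1 - q)
    (hξ2 : ∀ τ : ℝ, σ2 < τ → τ ≤ σ2 + c →
      ξ τ = (1 - q) * Real.exp (-(l * (τ - σ2)) / Pr))
    (hξ3 : ∀ τ : ℝ, σ2 + c < τ →
      ξ τ = (1 - q) * Real.exp (-(l * (τ - σ2)) / Pr)
        + q * (1 - Real.exp (-(l * (τ - σ2 - c)) / Pr))) :
    (q < 1 → StrictAntiOn ξ (Set.Ioc σ2 (σ2 + c))) ∧
    (1 / (1 + Real.exp μ) < q → StrictMonoOn ξ (Set.Ioi (σ2 + c))) ∧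
    (q < 1 / (1 + Real.exp μ) → StrictAntiOn ξ (Set.Ioi (σ2 + c))) := by
  have hE : ∀ a b : ℝ, a < b →
      Real.exp (-(l * (b - σ2)) / Pr) < Real.exp (-(l * (a - σ2)) / Pr) := by
    intro a b hab
    apply Real.exp_lt_exp.mpr
    apply div_lt_div_of_pos_right _ hPr
    nlinarith
  have h3 : ∀ τ : ℝ, σ2 + c < τ →
      ξ τ = q + (1 - q * (1 + Real.exp μ)) * Real.exp (-(l * (τ - σ2)) / Pr) := by
    intro τ hτ
    have e : Real.exp (-(l * (τ - σ2 - c)) / Pr)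
        = Real.exp μ * Real.exp (-(l * (τ - σ2)) / Pr) := by
      rw [← Real.exp_add, hμ]
      congr 1
      ring
    rw [hξ3 τ hτ, e]
    ring
  have hp : 0 < 1 + Real.exp μ := by positivity
  refine ⟨?_, ?_, ?_⟩
  · intro h a ha b hb hab
    rw [hξ2 a ha.1 ha.2, hξ2 b hb.1 hb.2]
    exact mul_lt_mul_of_pos_left (hE a b hab) (by linarith)
  · intro h a ha b hb hab
    rw [div_lt_iff₀ hp] at h
    rw [h3 a ha, h3 b hb]
    nlinarith [mul_pos (sub_pos.mpr h) (sub_pos.mpr (hE a b hab))]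
  · intro h a ha b hb hab
    rw [lt_div_iff₀ hp] at h
    rw [h3 a ha, h3 b hb]
    nlinarith [mul_pos (sub_pos.mpr h) (sub_pos.mpr (hE a b hab))]
end
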